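/- arXiv:1211.1477 — 3 statements merged into one kernel-verified Lean document; each statement's English description precedes it below -/
import Mathlib

section
/- Let (R,m) be a Noetherian local ring, I an ideal, N a finitely generated R-module, and r = depth(I,N) < ∞. If x_1,...,x_r is a regular sequence on N contained in I, then Ass_R(H^r_I(N)) = Ass_R(N/(x_1,...,x_r)N) ∩ V(I), where H^r_I denotes the r-th local cohomology module with support in I and V(I) is the set of primes containing I. -/
open CategoryTheory Opposite IsLocalRing

/-- Interpretation of an integer `k ≥ -1` in `WithBot ℕ∞`, for comparison with Krull dimensions. -/
noncomputable def zdim (k : ℤ) : WithBot (WithTop ℕ) :=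
  if k < 0 then ⊥ else ((k.toNat : WithTop ℕ) : WithBot (WithTop ℕ))

/-- The ideal generated by the first `j` entries of the sequence `x`. -/
def prefIdeal {R : Type} [CommRing R] {r : ℕ} (x : Fin r → R) (j : ℕ) : Ideal R :=
  Ideal.span (x '' {i | (i : ℕ) < j})

/-- `x` is an `N`-sequence in dimension `> k`: for each `i`, `x i` avoids every associated
prime `p` of `N/(x_0,…,x_{i-1})N` with `dim(R/p) > k`. -/
def IsSeqInDimGT (R : Type) [CommRing R] (N : Type) [AddCommGroup N] [Module R N]
    (k : ℤ) {r : ℕ} (x : Fin r → R) : Prop :=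
  ∀ i : Fin r, ∀ p ∈ associatedPrimes R (N ⧸ (prefIdeal x (i : ℕ) • ⊤ : Submodule R N)),
    zdim k < ringKrullDim (R ⧸ p) → x i ∉ p

/-- `depth_k(I,N)`: the common length of maximal `N`-sequences in dimension `> k`
contained in `I` (realized as the supremum of lengths of such sequences). -/
noncomputable def depthK (R : Type) [CommRing R] (k : ℤ) (I : Ideal R)
    (N : Type) [AddCommGroup N] [Module R N] : ℕ∞ :=
  sSup {n : ℕ∞ | ∃ (r : ℕ) (x : Fin r → R),
    (∀ i, x i ∈ I) ∧ IsSeqInDimGT R N k x ∧ n = (r : ℕ∞)}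

/-- The set of prime (or arbitrary) ideals `p` with `dim(R/p) ≥ k`. -/
def dimGE (R : Type) [CommRing R] (k : ℤ) : Set (Ideal R) :=
  {p | zdim k ≤ ringKrullDim (R ⧸ p)}

namespace CategoryTheory

open Limits

section LeftDerivedSequence

variable {C D : Type*} [Category* C] [Category* D] [Abelian C] [Abelian D]
  {F G H : C ⥤ D} [F.Additive] [G.Additive] [H.Additive] (α : F ⟶ G) (β : G ⟶ H)
  (w : α ≫ β = 0)

/-- The short complex of chain complexes obtained by applying `F ⟶ G ⟶ H` termwise. -/
noncomputable def mapChainShortComplex (K : ChainComplex C ℕ) :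
    ShortComplex (ChainComplex D ℕ) :=
  ShortComplex.mk ((NatTrans.mapHomologicalComplex α _).app K)
    ((NatTrans.mapHomologicalComplex β _).app K) (by
      ext n
      exact congr_app w (K.X n))

lemma mapChainShortComplex_shortExact
    (hS : ∀ (P : C) [Projective P],
      (ShortComplex.mk (α.app P) (β.app P) (congr_app w P)).ShortExact)
    {X : C} (P : ProjectiveResolution X) :
    (mapChainShortComplex α β w P.complex).ShortExact :=
  HomologicalComplex.shortExact_of_degreewise_shortExact _ fun n => hS (P.complex.X n)

variable (hS : ∀ (P : C) [Projective P],
  (ShortComplex.mk (α.app P) (β.app P) (congr_app w P)).ShortExact)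

/-- The connecting morphism computed on a projective resolution. -/
noncomputable def resolutionδ (n : ℕ) {X : C} (P : ProjectiveResolution X) :
    (HomologicalComplex.homologyFunctor D _ (n + 1)).obj
        ((H.mapHomologicalComplex (ComplexShape.down ℕ)).obj P.complex) ⟶
      (HomologicalComplex.homologyFunctor D _ n).obj
        ((F.mapHomologicalComplex (ComplexShape.down ℕ)).obj P.complex) :=
  (mapChainShortComplex_shortExact α β w hS P).δ (n + 1) n (ComplexShape.down_mk _ _ rfl)

lemma resolutionδ_naturality (n : ℕ) {X Y : C} (P : ProjectiveResolution X)
    (Q : ProjectiveResolution Y) (φ : P.complex ⟶ Q.complex) :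
    resolutionδ α β w hS n P ≫
        (F.mapHomologicalComplex _ ⋙ HomologicalComplex.homologyFunctor _ _ n).map φ =
      (H.mapHomologicalComplex _ ⋙ HomologicalComplex.homologyFunctor _ _ (n + 1)).map φ ≫
        resolutionδ α β w hS n Q := by
  let ψ : mapChainShortComplex α β w P.complex ⟶ mapChainShortComplex α β w Q.complex :=
    { τ₁ := (F.mapHomologicalComplex _).map φ
      τ₂ := (G.mapHomologicalComplex _).map φ
      τ₃ := (H.mapHomologicalComplex _).map φ
      comm₁₂ := (NatTrans.mapHomologicalComplex α _).naturality φ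
      comm₂₃ := (NatTrans.mapHomologicalComplex β _).naturality φ }
  exact HomologicalComplex.HomologySequence.δ_naturality ψ
    (mapChainShortComplex_shortExact α β w hS P)
    (mapChainShortComplex_shortExact α β w hS Q) (n + 1) n (ComplexShape.down_mk _ _ rfl)

variable [EnoughProjectives C]

/-- The connecting natural transformation between left derived functors attached to a sequence of
functors that is short exact on projective objects. -/
noncomputable def leftDerivedδ (n : ℕ) : H.leftDerived (n + 1) ⟶ F.leftDerived n where
  app X := ((projectiveResolution X).isoLeftDerivedObj H (n + 1)).hom ≫
    resolutionδ α β w hS n (projectiveResolution X) ≫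
      ((projectiveResolution X).isoLeftDerivedObj F n).inv
  naturality X Y f := by
    have hφ := ProjectiveResolution.lift_commutes_zero f (projectiveResolution X)
      (projectiveResolution Y)
    rw [ProjectiveResolution.isoLeftDerivedObj_hom_naturality_assoc f _ _ _ hφ,
      Category.assoc, Category.assoc,
      ProjectiveResolution.isoLeftDerivedObj_inv_naturality f _ _ _ hφ]
    exact congr_arg (_ ≫ ·) ((Category.assoc _ _ _).symm.trans ((congr_arg (· ≫ _)
      (resolutionδ_naturality α β w hS n _ _ _).symm).trans (Category.assoc _ _ _)))

lemma leftDerived_comp_δ (n : ℕ) :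
    NatTrans.leftDerived β (n + 1) ≫ leftDerivedδ α β w hS n = 0 := by
  ext X
  have : (HomologicalComplex.homologyFunctor D _ (n + 1)).map
      ((NatTrans.mapHomologicalComplex β _).app (projectiveResolution X).complex) ≫
        resolutionδ α β w hS n (projectiveResolution X) = 0 :=
    (mapChainShortComplex_shortExact α β w hS (projectiveResolution X)).comp_δ (n + 1) n _
  rw [NatTrans.comp_app, (projectiveResolution X).leftDerived_app_eq]
  simp only [leftDerivedδ, Category.assoc, Iso.inv_hom_id_assoc, reassoc_of% this, zero_comp,
    comp_zero, zero_app]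

lemma leftDerivedδ_comp (n : ℕ) :
    leftDerivedδ α β w hS n ≫ NatTrans.leftDerived α n = 0 := by
  ext X
  have : resolutionδ α β w hS n (projectiveResolution X) ≫
      (HomologicalComplex.homologyFunctor D _ n).map
        ((NatTrans.mapHomologicalComplex α _).app (projectiveResolution X).complex) = 0 :=
    (mapChainShortComplex_shortExact α β w hS (projectiveResolution X)).δ_comp (n + 1) n _
  rw [NatTrans.comp_app, (projectiveResolution X).leftDerived_app_eq]
  simp only [leftDerivedδ, Category.assoc, Iso.inv_hom_id_assoc, reassoc_of% this, zero_comp,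
    comp_zero, zero_app]

lemma leftDerivedδ_exact₃ (n : ℕ) (X : C) :
    (ShortComplex.mk ((NatTrans.leftDerived β (n + 1)).app X) ((leftDerivedδ α β w hS n).app X)
      (congr_app (leftDerived_comp_δ α β w hS n) X)).Exact := by
  let P := projectiveResolution X
  refine (ShortComplex.exact_iff_of_iso (ShortComplex.isoMk (P.isoLeftDerivedObj G (n + 1))
    (P.isoLeftDerivedObj H (n + 1)) (P.isoLeftDerivedObj F n) ?_ ?_)).2
    ((mapChainShortComplex_shortExact α β w hS P).homology_exact₃ (n + 1) n
      (ComplexShape.down_mk _ _ rfl))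
  · exact ((Iso.comp_inv_eq _).1 ((Category.assoc _ _ _).trans
      (P.leftDerived_app_eq β (n + 1)).symm)).trans rfl
  · exact ((Iso.comp_inv_eq _).1 (Category.assoc _ _ _)).trans rfl

lemma leftDerivedδ_exact₁ (n : ℕ) (X : C) :
    (ShortComplex.mk ((leftDerivedδ α β w hS n).app X) ((NatTrans.leftDerived α n).app X)
      (congr_app (leftDerivedδ_comp α β w hS n) X)).Exact := by
  let P := projectiveResolution X
  refine (ShortComplex.exact_iff_of_iso (ShortComplex.isoMk (P.isoLeftDerivedObj H (n + 1))
    (P.isoLeftDerivedObj F n) (P.isoLeftDerivedObj G n) ?_ ?_)).2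
    ((mapChainShortComplex_shortExact α β w hS P).homology_exact₁ (n + 1) n
      (ComplexShape.down_mk _ _ rfl))
  · exact ((Iso.comp_inv_eq _).1 (Category.assoc _ _ _)).trans rfl
  · exact ((Iso.comp_inv_eq _).1 ((Category.assoc _ _ _).trans
      (P.leftDerived_app_eq α n).symm)).trans rfl

end LeftDerivedSequence

section ExtSequence

universe u v

variable {R : Type*} [Ring R] {C : Type u} [Category.{v} C] [Abelian C] [Linear R C]

lemma linearYoneda_shortExact {S : ShortComplex C} (hS : S.ShortExact) (P : C) [Projective P] :
    (ShortComplex.mk (((linearYoneda R C).map S.f).app (op P))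
      (((linearYoneda R C).map S.g).app (op P))
      (by
        ext (f : P ⟶ S.X₁)
        exact (Category.assoc _ _ _).trans
          ((congr_arg (f ≫ ·) S.zero).trans comp_zero))).ShortExact where
  exact := (ShortComplex.moduleCat_exact_iff _).2 fun (f : P ⟶ S.X₂) hf => by
    have := hS.mono_f
    exact ⟨hS.exact.lift f hf, hS.exact.lift_f f hf⟩
  mono_f := (ModuleCat.mono_iff_injective _).2 fun (f : P ⟶ S.X₁) (g : P ⟶ S.X₁) h => by
    have := hS.mono_f
    exact (cancel_mono S.f).1 h
  epi_g := (ModuleCat.epi_iff_surjective _).2 fun (f : P ⟶ S.X₃) => by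
    have := hS.epi_g
    exact ⟨Projective.factorThru f S.g, Projective.factorThru_comp f S.g⟩

variable (R) in
lemma linearYoneda_rightOp_comp_eq_zero (S : ShortComplex C) :
    NatTrans.rightOp ((linearYoneda R C).map S.g) ≫ NatTrans.rightOp ((linearYoneda R C).map S.f) =
      0 := by
  ext X
  apply Quiver.Hom.unop_inj
  ext (f : X ⟶ S.X₁)
  exact (Category.assoc _ _ _).trans ((congr_arg (f ≫ ·) S.zero).trans comp_zero)

lemma linearYoneda_rightOp_shortExact {S : ShortComplex C} (hS : S.ShortExact) (P : C)
    [Projective P] :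
    (ShortComplex.mk ((NatTrans.rightOp ((linearYoneda R C).map S.g)).app P)
      ((NatTrans.rightOp ((linearYoneda R C).map S.f)).app P)
      (congr_app (linearYoneda_rightOp_comp_eq_zero R S) P)).ShortExact :=
  (linearYoneda_shortExact hS P).op

variable [EnoughProjectives C]

variable (R) in
/-- The connecting morphism for `Ext` attached to a short exact sequence in the second variable,
natural in the first variable. -/
noncomputable def extδ {S : ShortComplex C} (hS : S.ShortExact) (n : ℕ) :
    (Ext R C n).flip.obj S.X₃ ⟶ (Ext R C (n + 1)).flip.obj S.X₁ :=
  NatTrans.leftOp (leftDerivedδ (NatTrans.rightOp ((linearYoneda R C).map S.g))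
    (NatTrans.rightOp ((linearYoneda R C).map S.f)) (linearYoneda_rightOp_comp_eq_zero R S)
    (fun P _ => linearYoneda_rightOp_shortExact hS P) n)

lemma ext_map_comp_extδ {S : ShortComplex C} (hS : S.ShortExact) (n : ℕ) :
    (Ext R C n).flip.map S.g ≫ extδ R hS n = 0 := by
  ext X : 2
  exact congr_arg Quiver.Hom.unop (congr_app (leftDerivedδ_comp
    (NatTrans.rightOp ((linearYoneda R C).map S.g))
    (NatTrans.rightOp ((linearYoneda R C).map S.f)) (linearYoneda_rightOp_comp_eq_zero R S)
    (fun P _ => linearYoneda_rightOp_shortExact hS P) n) X.unop)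

lemma extδ_comp_ext_map {S : ShortComplex C} (hS : S.ShortExact) (n : ℕ) :
    extδ R hS n ≫ (Ext R C (n + 1)).flip.map S.f = 0 := by
  ext X : 2
  exact congr_arg Quiver.Hom.unop (congr_app (leftDerived_comp_δ
    (NatTrans.rightOp ((linearYoneda R C).map S.g))
    (NatTrans.rightOp ((linearYoneda R C).map S.f)) (linearYoneda_rightOp_comp_eq_zero R S)
    (fun P _ => linearYoneda_rightOp_shortExact hS P) n) X.unop)

lemma extδ_exact₃ {S : ShortComplex C} (hS : S.ShortExact) (n : ℕ) (X : Cᵒᵖ) :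
    (ShortComplex.mk (((Ext R C n).flip.map S.g).app X) ((extδ R hS n).app X)
      (congr_app (ext_map_comp_extδ hS n) X)).Exact :=
  (leftDerivedδ_exact₁ (NatTrans.rightOp ((linearYoneda R C).map S.g))
    (NatTrans.rightOp ((linearYoneda R C).map S.f)) (linearYoneda_rightOp_comp_eq_zero R S)
    (fun P _ => linearYoneda_rightOp_shortExact hS P) n X.unop).unop

lemma extδ_exact₁ {S : ShortComplex C} (hS : S.ShortExact) (n : ℕ) (X : Cᵒᵖ) :
    (ShortComplex.mk ((extδ R hS n).app X) (((Ext R C (n + 1)).flip.map S.f).app X)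
      (congr_app (extδ_comp_ext_map hS n) X)).Exact :=
  (leftDerivedδ_exact₃ (NatTrans.rightOp ((linearYoneda R C).map S.g))
    (NatTrans.rightOp ((linearYoneda R C).map S.f)) (linearYoneda_rightOp_comp_eq_zero R S)
    (fun P _ => linearYoneda_rightOp_shortExact hS P) n X.unop).unop

end ExtSequence

section ExtScalar

universe u v

variable {R : Type*} [CommRing R]

lemma _root_.ModuleCat.comp_smul_id_op {X Y : (ModuleCat R)ᵒᵖ} (f : X ⟶ Y) (a : R) :
    f ≫ (a • 𝟙 Y.unop).op = (a • 𝟙 X.unop).op ≫ f :=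
  Quiver.Hom.unop_inj ((Linear.smul_comp _ _ _ a _ _).trans
    (((congr_arg (a • ·) ((Category.id_comp _).trans (Category.comp_id _).symm))).trans
      (Linear.comp_smul _ _ _ _ a _).symm))

/-- A chain endomorphism in the opposite of a module category which is multiplication by `a`
in degree `n` induces multiplication by `a` on homology in degree `n`. -/
lemma homologyMap_eq_smul_id_op {K : ChainComplex (ModuleCat R)ᵒᵖ ℕ} (φ : K ⟶ K) (a : R) (n : ℕ)
    (hφ : φ.f n = (a • 𝟙 (K.X n).unop).op) :
    HomologicalComplex.homologyMap φ n = (a • 𝟙 (K.homology n).unop).op := by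
  rw [← cancel_epi (K.homologyπ n), HomologicalComplex.homologyπ_naturality,
    ModuleCat.comp_smul_id_op]
  congr 1
  rw [← cancel_mono (K.iCycles n), HomologicalComplex.cyclesMap_i, hφ,
    ModuleCat.comp_smul_id_op]

lemma eq_smul_id_op_of_iso {X Y : (ModuleCat R)ᵒᵖ} (e : X ≅ Y) {f : X ⟶ X} {g : Y ⟶ Y} {a : R}
    (h : f ≫ e.hom = e.hom ≫ g) (hg : g = (a • 𝟙 Y.unop).op) : f = (a • 𝟙 X.unop).op := by
  rwa [hg, ModuleCat.comp_smul_id_op, cancel_mono] at h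

variable {C : Type u} [Category.{v} C] [Abelian C] [Linear R C] [EnoughProjectives C]

lemma Ext_map_smul_id (n : ℕ) (X : C) (a : R) (Y : C) :
    ((Ext R C n).map (a • 𝟙 X).op).app Y = a • 𝟙 (((Ext R C n).obj (op X)).obj Y) := by
  let P := projectiveResolution X
  let F := ((linearYoneda R C).obj Y).rightOp
  refine congr_arg Quiver.Hom.unop (eq_smul_id_op_of_iso (P.isoLeftDerivedObj F n)
    (P.isoLeftDerivedObj_hom_naturality (a • 𝟙 X) P (a • 𝟙 P.complex) ?_ F n)
    (homologyMap_eq_smul_id_op _ a n ?_))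
  · rw [HomologicalComplex.smul_f_apply, HomologicalComplex.id_f]
    exact (Linear.smul_comp _ _ _ a _ _).trans ((congr_arg (a • ·) ((Category.id_comp _).trans
      (Category.comp_id _).symm)).trans (Linear.comp_smul _ _ _ _ a _).symm)
  · apply Quiver.Hom.unop_inj
    ext (f : P.complex.X n ⟶ Y)
    exact (Linear.smul_comp _ _ _ a _ f).trans (congr_arg (a • ·) (Category.id_comp f))

lemma Ext_obj_map_smul_id (n : ℕ) (X : Cᵒᵖ) (Y : C) (a : R) :
    ((Ext R C n).obj X).map (a • 𝟙 Y) = a • 𝟙 (((Ext R C n).obj X).obj Y) := by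
  let P := projectiveResolution X.unop
  have h := P.leftDerived_app_eq (NatTrans.rightOp ((linearYoneda R C).map (a • 𝟙 Y))) n
  refine congr_arg Quiver.Hom.unop (eq_smul_id_op_of_iso (P.isoLeftDerivedObj _ n)
    ((Iso.eq_comp_inv _).1 (h.trans (Category.assoc _ _ _).symm))
    (homologyMap_eq_smul_id_op _ a n ?_))
  apply Quiver.Hom.unop_inj
  ext (f : P.complex.X n ⟶ Y)
  exact (Linear.comp_smul _ _ _ f a _).trans (congr_arg (a • ·) (Category.comp_id f))

lemma Ext_smul_id_eq_zero (n : ℕ) {X : C} {a : R} (h : a • 𝟙 X = 0) (Y : C) :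
    a • 𝟙 (((Ext R C n).obj (op X)).obj Y) = 0 := by
  rw [← Ext_map_smul_id, h, ← zero_smul R (𝟙 X), Ext_map_smul_id, zero_smul]

variable (R) in
/-- The natural comparison `Hom(X, Y) ⟶ Ext⁰(X, Y)`. -/
noncomputable def homToExtZero (Y : C) :
    (linearYoneda R C).obj Y ⟶ (Ext R C 0).flip.obj Y :=
  NatTrans.leftOp ((linearYoneda R C).obj Y).rightOp.fromLeftDerivedZero

instance linearYoneda_obj_preservesFiniteLimits (Y : C) :
    PreservesFiniteLimits ((linearYoneda R C).obj Y) where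
  preservesFiniteLimits J _ _ := by
    have : PreservesLimitsOfShape J ((linearYoneda R C).obj Y ⋙ forget (ModuleCat R)) :=
      inferInstanceAs (PreservesLimitsOfShape J (yoneda.obj Y))
    exact preservesLimitsOfShape_of_reflects_of_preserves _ (forget (ModuleCat R))

instance (Y : C) : IsIso (homToExtZero R Y) := by
  have := preservesFiniteColimits_rightOp ((linearYoneda R C).obj Y)
  have (X : Cᵒᵖ) : IsIso ((homToExtZero R Y).app X) :=
    isIso_unop (((linearYoneda R C).obj Y).rightOp.fromLeftDerivedZero.app X.unop)
  exact NatIso.isIso_of_isIso_app _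

end ExtScalar

end CategoryTheory

namespace localCohomology

open Limits

universe u

variable {R : Type u} [CommRing R] (I : Ideal R)

/-- The directed system whose colimit is the local cohomology of a fixed module. -/
noncomputable def extSystem (n : ℕ) (M : ModuleCat.{u} R) : ℕᵒᵖᵒᵖ ⥤ ModuleCat.{u} R :=
  (ringModIdeals (idealPowersDiagram I)).op ⋙ (Ext R (ModuleCat.{u} R) n).flip.obj M

/-- Local cohomology of a fixed module as a cocone over its system of `Ext` modules. -/
noncomputable def extCocone (n : ℕ) (M : ModuleCat.{u} R) : Cocone (extSystem I n M) :=
  ((evaluation _ _).obj M).mapCocone (colimit.cocone (diagram (idealPowersDiagram I) n))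

/-- Local cohomology of a fixed module is the colimit of its system of `Ext` modules. -/
noncomputable def isColimitExtCocone (n : ℕ) (M : ModuleCat.{u} R) :
    IsColimit (extCocone I n M) :=
  isColimitOfPreserves ((evaluation _ _).obj M)
    (colimit.isColimit (diagram (idealPowersDiagram I) n))

lemma extCocone_ι_map (n : ℕ) {M N : ModuleCat.{u} R} (f : M ⟶ N) (t : ℕᵒᵖᵒᵖ) :
    (extCocone I n M).ι.app t ≫ (localCohomology I n).map f =
      (Functor.whiskerLeft (ringModIdeals (idealPowersDiagram I)).op
        ((Ext R (ModuleCat.{u} R) n).flip.map f)).app t ≫ (extCocone I n N).ι.app t :=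
  ((colimit.ι (diagram (idealPowersDiagram I) n) t).naturality f).symm

/-- The connecting morphism in local cohomology. -/
noncomputable def δ {S : ShortComplex (ModuleCat.{u} R)} (hS : S.ShortExact) (n : ℕ) :
    (localCohomology I n).obj S.X₃ ⟶ (localCohomology I (n + 1)).obj S.X₁ :=
  (isColimitExtCocone I n S.X₃).map (extCocone I (n + 1) S.X₁)
    (Functor.whiskerLeft (ringModIdeals (idealPowersDiagram I)).op (extδ R hS n))

lemma extCocone_ι_δ {S : ShortComplex (ModuleCat.{u} R)} (hS : S.ShortExact) (n : ℕ)
    (t : ℕᵒᵖᵒᵖ) :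
    (extCocone I n S.X₃).ι.app t ≫ δ I hS n =
      (Functor.whiskerLeft (ringModIdeals (idealPowersDiagram I)).op (extδ R hS n)).app t ≫
        (extCocone I (n + 1) S.X₁).ι.app t :=
  (isColimitExtCocone I n S.X₃).ι_map _ _ _

instance : PreservesFilteredColimitsOfSize.{0, 0} (forget (ModuleCat.{u} R)) :=
  preservesSmallestFilteredColimits_of_preservesFilteredColimits _

/-- A sequence of filtered colimits of modules is exact if it is exact termwise. -/
lemma exact_of_isColimit {J : Type} [SmallCategory J] [IsFiltered J]
    {F G H : J ⥤ ModuleCat.{u} R} {α : F ⟶ G} {β : G ⟶ H}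
    (w : ∀ j, α.app j ≫ β.app j = 0)
    (hE : ∀ j, (ShortComplex.mk (α.app j) (β.app j) (w j)).Exact)
    {c : Cocone F} {d : Cocone G} {e : Cocone H} (hd : IsColimit d)
    (he : IsColimit e) (f : c.pt ⟶ d.pt) (g : d.pt ⟶ e.pt)
    (hf : ∀ j, c.ι.app j ≫ f = α.app j ≫ d.ι.app j)
    (hg : ∀ j, d.ι.app j ≫ g = β.app j ≫ e.ι.app j) (y : d.pt) (hy : g y = 0) :
    ∃ x, f x = y := by
  obtain ⟨j, b, rfl⟩ := Concrete.isColimit_exists_rep _ hd y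
  have h1 : e.ι.app j (β.app j b) = e.ι.app j 0 := by
    rw [map_zero, ← hy, ← ConcreteCategory.comp_apply, ← hg]; rfl
  obtain ⟨k, φ, hk⟩ := (he.eq_iff' _ _).1 h1
  have h2 : β.app k (G.map φ b) = 0 := by
    rw [map_zero] at hk
    rw [← hk, ← ConcreteCategory.comp_apply, β.naturality]; rfl
  obtain ⟨a, ha⟩ := (ShortComplex.moduleCat_exact_iff _).1 (hE k) _ h2
  refine ⟨c.ι.app k a, ?_⟩
  rw [← ConcreteCategory.comp_apply, hf, ConcreteCategory.comp_apply]
  change d.ι.app k (α.app k a) = _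
  erw [ha]
  rw [← ConcreteCategory.comp_apply, d.w]

lemma exists_map_eq_of_δ_eq_zero {S : ShortComplex (ModuleCat.{u} R)} (hS : S.ShortExact) (n : ℕ)
    (y : (localCohomology I n).obj S.X₃) (hy : δ I hS n y = 0) :
    ∃ z, (localCohomology I n).map S.g z = y :=
  exact_of_isColimit (fun _ => congr_app (ext_map_comp_extδ hS n) _)
    (fun _ => extδ_exact₃ hS n _) (isColimitExtCocone I n _) (isColimitExtCocone I (n + 1) _)
    _ _ (extCocone_ι_map I n _) (extCocone_ι_δ I _ n) y hy

lemma exists_δ_eq_of_map_eq_zero {S : ShortComplex (ModuleCat.{u} R)} (hS : S.ShortExact) (n : ℕ)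
    (y : (localCohomology I (n + 1)).obj S.X₁) (hy : (localCohomology I (n + 1)).map S.f y = 0) :
    ∃ z, δ I hS n z = y :=
  exact_of_isColimit (fun _ => congr_app (extδ_comp_ext_map hS n) _)
    (fun _ => extδ_exact₁ hS n _) (isColimitExtCocone I (n + 1) _)
    (isColimitExtCocone I (n + 1) _) _ _ (extCocone_ι_δ I _ n) (extCocone_ι_map I (n + 1) _) y hy

lemma exists_ι_eq (n : ℕ) (M : ModuleCat.{u} R) (h : (localCohomology I n).obj M) :
    ∃ (t : ℕᵒᵖᵒᵖ) (e : (extSystem I n M).obj t), (extCocone I n M).ι.app t e = h :=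
  Concrete.isColimit_exists_rep _ (isColimitExtCocone I n M) h

lemma map_smul_id (n : ℕ) (M : ModuleCat.{u} R) (a : R) :
    (localCohomology I n).map (a • 𝟙 M) = a • 𝟙 ((localCohomology I n).obj M) := by
  refine (isColimitExtCocone I n M).hom_ext fun t => ?_
  refine (extCocone_ι_map I n _ t).trans ?_
  refine (congr_arg (· ≫ _) (Ext_obj_map_smul_id n _ M a)).trans ?_
  exact (Linear.smul_comp _ _ _ a _ _).trans ((congr_arg (a • ·) ((Category.id_comp _).trans
      (Category.comp_id _).symm)).trans (Linear.comp_smul _ _ _ _ a _).symm)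

/-- Local cohomology is torsion: every element is killed by a power of the ideal. -/
lemma exists_pow_smul_eq_zero (n : ℕ) (M : ModuleCat.{u} R)
    (h : (localCohomology I n).obj M) : ∃ t : ℕ, ∀ a ∈ I ^ t, a • h = 0 := by
  obtain ⟨t, e, rfl⟩ := exists_ι_eq I n M h
  refine ⟨t.unop.unop, fun a ha => ?_⟩
  have h0 : a • 𝟙 ((ringModIdeals (idealPowersDiagram I)).obj t.unop) = 0 := by
    ext x
    obtain ⟨y, rfl⟩ := Ideal.Quotient.mk_surjective x
    exact Ideal.Quotient.eq_zero_iff_mem.2 (Ideal.mul_mem_right y _ ha)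
  have h1 : a • e = 0 := congr_arg (fun f => f.hom e) (Ext_smul_id_eq_zero n h0 M)
  exact (map_smul ((extCocone I n M).ι.app t).hom a e).symm.trans
    ((congr_arg _ h1).trans (map_zero _))

section RegularElement

variable {I} {M : ModuleCat.{u} R} {x : R} (hx : IsSMulRegular M x)

lemma δ_injective (n : ℕ) [Subsingleton ((localCohomology I n).obj M)] :
    Function.Injective (δ I hx.smulShortComplex_shortExact n) := by
  refine (injective_iff_map_eq_zero (δ I hx.smulShortComplex_shortExact n).hom).2 fun y hy => ?_
  obtain ⟨z, rfl⟩ := exists_map_eq_of_δ_eq_zero I hx.smulShortComplex_shortExact n y hy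
  rw [show z = 0 from Subsingleton.elim (α := (localCohomology I n).obj M) z 0]
  exact map_zero ((localCohomology I n).map _).hom

lemma mem_range_δ (n : ℕ) {y : (localCohomology I (n + 1)).obj M} (hy : x • y = 0) :
    ∃ z, δ I hx.smulShortComplex_shortExact n z = y :=
  exists_δ_eq_of_map_eq_zero I hx.smulShortComplex_shortExact n y
    ((congr_arg (fun f => f.hom y) (map_smul_id I (n + 1) M x)).trans hy)

end RegularElement

/-- Evaluation of homomorphisms `R ⧸ I ^ t ⟶ M` at `1`, as a cocone over `t`. -/
noncomputable def evalOneCocone (M : ModuleCat.{u} R) :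
    Cocone ((ringModIdeals (idealPowersDiagram I)).op ⋙
      (linearYoneda R (ModuleCat.{u} R)).obj M) where
  pt := M
  ι :=
    { app t := ModuleCat.ofHom
        { toFun (f : (ringModIdeals (idealPowersDiagram I)).obj t.unop ⟶ M) :=
            f.hom (Ideal.Quotient.mk _ (1 : R))
          map_add' _ _ := rfl
          map_smul' _ _ := rfl }
      naturality _ _ _ := rfl }

/-- The map from the zeroth local cohomology of a module to the module. -/
noncomputable def zeroι (M : ModuleCat.{u} R) : (localCohomology I 0).obj M ⟶ M :=
  (isColimitExtCocone I 0 M).map (evalOneCocone I M)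
    (Functor.whiskerLeft _ (inv (homToExtZero R M)))

lemma zeroι_ι (M : ModuleCat.{u} R) (t : ℕᵒᵖᵒᵖ)
    (f : (ringModIdeals (idealPowersDiagram I)).obj t.unop ⟶ M) :
    zeroι I M ((extCocone I 0 M).ι.app t ((homToExtZero R M).app _ f)) =
      f.hom (Ideal.Quotient.mk _ (1 : R)) := by
  have h := (isColimitExtCocone I 0 M).ι_map (evalOneCocone I M)
    (Functor.whiskerLeft _ (inv (homToExtZero R M))) t
  have h' := congr_app (IsIso.hom_inv_id (homToExtZero R M))
    (op ((ringModIdeals (idealPowersDiagram I)).obj t.unop))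
  refine (congr_arg (fun g => g.hom ((homToExtZero R M).app _ f)) h).trans ?_
  exact congr_arg (fun g => (g.hom f).hom (Ideal.Quotient.mk _ (1 : R))) h'

lemma exists_ι_homToExtZero_eq (M : ModuleCat.{u} R) (h : (localCohomology I 0).obj M) :
    ∃ (t : ℕᵒᵖᵒᵖ) (f : (ringModIdeals (idealPowersDiagram I)).obj t.unop ⟶ M),
      (extCocone I 0 M).ι.app t ((homToExtZero R M).app _ f) = h := by
  obtain ⟨t, e, rfl⟩ := exists_ι_eq I 0 M h
  have h' := congr_app (IsIso.inv_hom_id (homToExtZero R M))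
    (op ((ringModIdeals (idealPowersDiagram I)).obj t.unop))
  exact ⟨t, (inv (homToExtZero R M)).app _ e,
    congr_arg (fun g => (extCocone I 0 M).ι.app t (g.hom e)) h'⟩

lemma zeroι_injective (M : ModuleCat.{u} R) : Function.Injective (zeroι I M) := by
  refine (injective_iff_map_eq_zero (zeroι I M).hom).2 fun y hy => ?_
  obtain ⟨t, f, rfl⟩ := exists_ι_homToExtZero_eq I M y
  obtain rfl : f = 0 := by
    ext x
    obtain ⟨a, rfl⟩ := Ideal.Quotient.mk_surjective x
    have h1 := (zeroι_ι I M t f).symm.trans hy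
    have h2 := map_smul f.hom a (Ideal.Quotient.mk _ (1 : R))
    refine Eq.trans (congr_arg f.hom ?_) (h2.trans ((congr_arg (a • ·) h1).trans (smul_zero a)))
    exact (congr_arg (Ideal.Quotient.mk _) (mul_one a).symm).trans rfl
  exact (congr_arg _ (map_zero _)).trans (map_zero ((extCocone I 0 M).ι.app t).hom)

lemma mem_range_zeroι (M : ModuleCat.{u} R) (m : M) (hm : ∀ a ∈ I, a • m = 0) :
    ∃ h, zeroι I M h = m := by
  let f : (ringModIdeals (idealPowersDiagram I)).obj (op 1) ⟶ M :=
    ModuleCat.ofHom (Submodule.liftQ (I ^ 1) (LinearMap.toSpanSingleton R M m) fun a ha =>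
      hm a (by simpa using ha))
  exact ⟨_, (zeroι_ι I M (op (op 1)) f).trans (one_smul R m)⟩

/-- Local cohomology vanishes if some element of the ideal acts injectively on it. -/
lemma subsingleton_of_smul_eq_zero {x : R} (hx : x ∈ I) (n : ℕ) (M : ModuleCat.{u} R)
    (h : ∀ y : (localCohomology I n).obj M, x • y = 0 → y = 0) :
    Subsingleton ((localCohomology I n).obj M) := by
  refine subsingleton_of_forall_eq 0 fun y => ?_
  obtain ⟨t, ht⟩ := exists_pow_smul_eq_zero I n M y
  have key (k : ℕ) : x ^ k • y = 0 → y = 0 := by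
    induction k with
    | zero => simp
    | succ k ih => exact fun hk => ih (h _ (by rwa [smul_smul, ← pow_succ']))
  exact key t (ht _ (Ideal.pow_mem_pow hx t))

/-- Local cohomology vanishes below the length of a weakly regular sequence in the ideal. -/
lemma subsingleton_of_isWeaklyRegular (rs : List R) (hrs : ∀ x ∈ rs, x ∈ I) (M : ModuleCat.{u} R)
    (hreg : RingTheory.Sequence.IsWeaklyRegular M rs) (n : ℕ) (hn : n < rs.length) :
    Subsingleton ((localCohomology I n).obj M) := by
  induction rs generalizing M n with
  | nil => simp at hn
  | cons x rs ih =>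
    obtain ⟨hx, hreg⟩ := (RingTheory.Sequence.isWeaklyRegular_cons_iff M x rs).1 hreg
    refine subsingleton_of_smul_eq_zero I (hrs x (by simp)) n M fun y hy => ?_
    cases n with
    | zero =>
      refine zeroι_injective I M (Eq.trans (hx ?_) (map_zero (zeroι I M).hom).symm)
      exact (map_smul (zeroι I M).hom x y).symm.trans
        ((congr_arg _ hy).trans ((map_zero _).trans (smul_zero x).symm))
    | succ n =>
      obtain ⟨z, rfl⟩ := mem_range_δ hx n hy
      have := ih (fun z hz => hrs z (by simp [hz])) (ModuleCat.of R (QuotSMulTop x M)) hreg n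
        (by simpa using hn)
      rw [show z = 0 from Subsingleton.elim
        (α := (localCohomology I n).obj (ModuleCat.of R (QuotSMulTop x M))) z 0]
      exact map_zero (δ I hx.smulShortComplex_shortExact n).hom

lemma _root_.IsAssociatedPrime.of_injective_of_forall_mem_range [IsNoetherianRing R]
    {M N : Type*} [AddCommGroup M] [AddCommGroup N] [Module R M] [Module R N] {f : M →ₗ[R] N}
    (hf : Function.Injective f) {p : Ideal R} (hp : IsAssociatedPrime p N)
    (h : ∀ n : N, (∀ a ∈ p, a • n = 0) → ∃ m, f m = n) : IsAssociatedPrime p M := by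
  obtain ⟨hp, n, hn⟩ := isAssociatedPrime_iff.1 hp
  have hn' (a : R) : a ∈ p ↔ a • n = 0 := by
    rw [hn, Submodule.mem_colon_singleton, Submodule.mem_bot]
  obtain ⟨m, rfl⟩ := h n fun a ha => (hn' a).1 ha
  refine isAssociatedPrime_iff.2 ⟨hp, m, ?_⟩
  ext a
  rw [hn', Submodule.mem_colon_singleton, Submodule.mem_bot, ← map_smul, map_eq_zero_iff f hf]

variable [IsNoetherianRing R]

lemma le_of_mem_associatedPrimes {n : ℕ} {M : ModuleCat.{u} R} {p : Ideal R}
    (hp : p ∈ associatedPrimes R ((localCohomology I n).obj M)) : I ≤ p := by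
  obtain ⟨hp, h, hh⟩ := isAssociatedPrime_iff.1 hp
  obtain ⟨t, ht⟩ := exists_pow_smul_eq_zero I n M h
  refine hp.le_of_pow_le (n := t) fun a ha => ?_
  rw [hh, Submodule.mem_colon_singleton, Submodule.mem_bot]
  exact ht a ha

lemma associatedPrimes_zero (M : ModuleCat.{u} R) :
    associatedPrimes R ((localCohomology I 0).obj M) = associatedPrimes R M ∩ {p | I ≤ p} := by
  ext p
  exact ⟨fun hp => ⟨hp.map_of_injective (zeroι I M).hom (zeroι_injective I M),
    le_of_mem_associatedPrimes I hp⟩, fun ⟨hp, hI⟩ =>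
      hp.of_injective_of_forall_mem_range (zeroι_injective I M) fun m hm =>
        mem_range_zeroι I M m fun a ha => hm a (hI ha)⟩

/-- Dividing by a regular element lowers the degree in which local cohomology with a given set of
associated primes appears. -/
lemma associatedPrimes_succ {M : ModuleCat.{u} R} {x : R} (hx : IsSMulRegular M x) (hxI : x ∈ I)
    (n : ℕ) [Subsingleton ((localCohomology I n).obj M)] :
    associatedPrimes R ((localCohomology I (n + 1)).obj M) =
      associatedPrimes R ((localCohomology I n).obj (ModuleCat.of R (QuotSMulTop x M))) := by
  ext p
  exact ⟨fun hp => IsAssociatedPrime.of_injective_of_forall_mem_range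
    (f := (δ I hx.smulShortComplex_shortExact n).hom) (δ_injective hx n) hp
      fun y hy => mem_range_δ hx n (hy x (le_of_mem_associatedPrimes I hp hxI)),
    fun hp => IsAssociatedPrime.map_of_injective
      (δ I hx.smulShortComplex_shortExact n).hom hp (δ_injective hx n)⟩

/-- The associated primes of local cohomology in the degree given by the length of a weakly regular
sequence contained in the ideal. -/
theorem associatedPrimes_of_isWeaklyRegular (rs : List R) (hrs : ∀ x ∈ rs, x ∈ I)
    (M : Type u) [AddCommGroup M] [Module R M] (hreg : RingTheory.Sequence.IsWeaklyRegular M rs) :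
    associatedPrimes R ((localCohomology I rs.length).obj (ModuleCat.of R M)) =
      associatedPrimes R (M ⧸ (Ideal.ofList rs • ⊤ : Submodule R M)) ∩ {p | I ≤ p} := by
  induction rs generalizing M with
  | nil =>
    refine (associatedPrimes_zero I _).trans (congr_arg (· ∩ _) ?_)
    refine LinearEquiv.AssociatedPrimes.eq (Submodule.quotEquivOfEqBot _ ?_).symm
    rw [Ideal.ofList_nil, Submodule.bot_smul]
  | cons x rs ih =>
    have := subsingleton_of_isWeaklyRegular I _ hrs (ModuleCat.of R M) hreg rs.length (by simp)
    obtain ⟨hx, hreg⟩ := (RingTheory.Sequence.isWeaklyRegular_cons_iff M x rs).1 hreg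
    refine (associatedPrimes_succ (M := ModuleCat.of R M) I hx (hrs x (by simp)) rs.length).trans
      ((ih (fun z hz => hrs z (by simp [hz])) _ hreg).trans (congr_arg (· ∩ _) ?_))
    exact (LinearEquiv.AssociatedPrimes.eq
      (Submodule.quotOfListConsSMulTopEquivQuotSMulTopInner M x rs)).symm

end localCohomology

/-- If `r = depth(I,N) < ∞` and `x₁,…,x_r` is a regular sequence on `N` contained in `I`, then
`Ass_R(H^r_I(N)) = Ass_R(N/(x₁,…,x_r)N) ∩ V(I)`. -/
theorem ass_localCohomology_depth (R : Type) [CommRing R] [IsNoetherianRing R] [IsLocalRing R]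
    (I : Ideal R) (N : Type) [AddCommGroup N] [Module R N] [Module.Finite R N]
    (hIN : (I • ⊤ : Submodule R N) ≠ ⊤)
    (r : ℕ) (hr : depthK R (-1) I N = (r : ℕ∞))
    (x : Fin r → R) (hxI : ∀ i, x i ∈ I)
    (hreg : RingTheory.Sequence.IsRegular N (List.ofFn x)) :
    associatedPrimes R ((localCohomology I r).obj (ModuleCat.of R N))
      = associatedPrimes R (N ⧸ (prefIdeal x r • ⊤ : Submodule R N)) ∩ {p | I ≤ p} := by
  have hx : prefIdeal x r = Ideal.ofList (List.ofFn x) := by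
    simp [prefIdeal, Ideal.ofList, Set.range]
  rw [hx, ← localCohomology.associatedPrimes_of_isWeaklyRegular I _ (by simpa using hxI) N
    hreg.toIsWeaklyRegular, List.length_ofFn]
end

section
/- Let (R,m) be a Noetherian local ring, N a finitely generated R-module, k ≥ -1 an integer, and x_1,...,x_r an N-sequence in dimension > k (not necessarily permutable). Then for all positive integers n_1,...,n_r, ⋃_{j≤r} {p ∈ Ass_R(N/(x_1^{n_1},...,x_j^{n_j})N) : dim(R/p) ≥ k} = ⋃_{j≤r} {p ∈ Ass_R(N/(x_1,...,x_j)N) : dim(R/p) ≥ k}. In particular, ⋃ over all (n_1,...,n_r) ∈ ℕ^r of ⋃_{j≤r} Ass_R(N/(x_1^{n_1},...,x_j^{n_j})N)_{≥k} is a finite set. -/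
open CategoryTheory Opposite IsLocalRing

section ExactSequences

open RingTheory.Sequence Function

variable {R A B C : Type*} [CommRing R] [AddCommGroup A] [AddCommGroup B] [AddCommGroup C]
  [Module R A] [Module R B] [Module R C]

theorem isWeaklyRegular_of_subsingleton [Subsingleton A] (rs : List R) : IsWeaklyRegular A rs :=
  ⟨fun _ _ => Function.injective_of_subsingleton _⟩

/-- A short exact sequence stays exact modulo a weakly regular sequence on its last term. -/
theorem shortExact_mapQ_of_isWeaklyRegular {f : A →ₗ[R] B} {g : B →ₗ[R] C}
    (hf : Injective f) (hfg : Exact f g) (hg : Surjective g) {rs : List R}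
    (hC : IsWeaklyRegular C rs) :
    Injective (Submodule.mapQ _ _ f (Submodule.smul_top_le_comap_smul_top (Ideal.ofList rs) f)) ∧
      Exact (Submodule.mapQ _ _ f (Submodule.smul_top_le_comap_smul_top (Ideal.ofList rs) f))
        (Submodule.mapQ _ _ g (Submodule.smul_top_le_comap_smul_top (Ideal.ofList rs) g)) := by
  constructor
  · have h := map_first_exact_on_four_term_right_exact_of_isSMulRegular_last (rs := rs)
      (f₁ := (0 : PUnit →ₗ[R] A)) ((LinearMap.exact_zero_iff_injective PUnit f).mpr hf) hfg hg hC
    rw [← LinearMap.ker_eq_bot, LinearMap.ker_eq_bot']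
    intro m hm
    obtain ⟨z, rfl⟩ := (h m).mp hm
    rw [Subsingleton.elim z 0, map_zero]
  · exact map_first_exact_on_four_term_right_exact_of_isSMulRegular_last hfg
      (f₃ := (0 : C →ₗ[R] PUnit)) ((LinearMap.exact_zero_iff_surjective PUnit g).mpr hg)
      (surjective_to_subsingleton _) (isWeaklyRegular_of_subsingleton rs)

theorem RingTheory.Sequence.IsWeaklyRegular.take {rs : List R} (h : IsWeaklyRegular A rs)
    (i : ℕ) : IsWeaklyRegular A (rs.take i) :=
  ((isWeaklyRegular_append_iff A _ _).mp ((rs.take_append_drop i).symm ▸ h)).1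

theorem isWeaklyRegular_of_shortExact {f : A →ₗ[R] B} {g : B →ₗ[R] C}
    (hf : Injective f) (hfg : Exact f g) (hg : Surjective g) {rs : List R}
    (hA : IsWeaklyRegular A rs) (hC : IsWeaklyRegular C rs) : IsWeaklyRegular B rs := by
  refine ⟨fun i hi => ?_⟩
  obtain ⟨h₁, h₂⟩ := shortExact_mapQ_of_isWeaklyRegular hf hfg hg (hC.take i)
  exact isSMulRegular_of_range_eq_ker h₁ (LinearMap.exact_iff.mp h₂).symm
    (hA.regular_mod_prev i hi) (hC.regular_mod_prev i hi)

end ExactSequences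

section Powers

open RingTheory.Sequence Function
open scoped Pointwise

variable {R M : Type*} [CommRing R] [AddCommGroup M] [Module R M]

/-- For `r` regular on `M`, there is an exact sequence
`0 → M / r ^ n M → M / r ^ (n + 1) M → M / r M → 0`. -/
theorem exists_shortExact_quotSMulTop_pow {r : R} (hr : IsSMulRegular M r) (n : ℕ) :
    ∃ (f : QuotSMulTop (r ^ n) M →ₗ[R] QuotSMulTop (r ^ (n + 1)) M)
      (g : QuotSMulTop (r ^ (n + 1)) M →ₗ[R] QuotSMulTop r M),
      Injective f ∧ Exact f g ∧ Surjective g := by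
  have hf : (r ^ n • ⊤ : Submodule R M) ≤
      (r ^ (n + 1) • ⊤ : Submodule R M).comap (LinearMap.lsmul R M r) := by
    intro x hx
    obtain ⟨y, -, rfl⟩ := (Submodule.mem_smul_pointwise_iff_exists _ _ _).mp hx
    exact (Submodule.mem_smul_pointwise_iff_exists _ _ _).mpr
      ⟨y, trivial, by simp [pow_succ, mul_smul]⟩
  have hg : (r ^ (n + 1) • ⊤ : Submodule R M) ≤
      (r • ⊤ : Submodule R M).comap LinearMap.id := by
    intro x hx
    obtain ⟨y, -, rfl⟩ := (Submodule.mem_smul_pointwise_iff_exists _ _ _).mp hx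
    exact (Submodule.mem_smul_pointwise_iff_exists _ _ _).mpr
      ⟨r ^ n • y, trivial, by simp [pow_succ', mul_smul]⟩
  refine ⟨Submodule.mapQ _ _ _ hf, Submodule.mapQ _ _ _ hg, ?_, ?_, ?_⟩
  · rw [← LinearMap.ker_eq_bot, LinearMap.ker_eq_bot']
    intro x hx
    obtain ⟨x, rfl⟩ := Submodule.Quotient.mk_surjective _ x
    rw [Submodule.mapQ_apply, Submodule.Quotient.mk_eq_zero] at hx
    obtain ⟨y, -, hy⟩ := (Submodule.mem_smul_pointwise_iff_exists _ _ _).mp hx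
    rw [pow_succ', mul_smul] at hy
    exact (Submodule.Quotient.mk_eq_zero _).mpr
      ((Submodule.mem_smul_pointwise_iff_exists _ _ _).mpr ⟨y, trivial, hr hy⟩)
  · intro x
    obtain ⟨x, rfl⟩ := Submodule.Quotient.mk_surjective _ x
    constructor
    · intro hx
      rw [Submodule.mapQ_apply, Submodule.Quotient.mk_eq_zero] at hx
      obtain ⟨y, -, hy⟩ := (Submodule.mem_smul_pointwise_iff_exists _ _ _).mp hx
      exact ⟨Submodule.Quotient.mk y, congrArg Submodule.Quotient.mk hy⟩
    · rintro ⟨y, hy⟩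
      obtain ⟨y, rfl⟩ := Submodule.Quotient.mk_surjective _ y
      rw [← hy, Submodule.mapQ_apply, Submodule.mapQ_apply, Submodule.Quotient.mk_eq_zero]
      exact (Submodule.mem_smul_pointwise_iff_exists _ _ _).mpr ⟨y, trivial, rfl⟩
  · intro x
    obtain ⟨x, rfl⟩ := Submodule.Quotient.mk_surjective _ x
    exact ⟨Submodule.Quotient.mk x, rfl⟩

theorem isWeaklyRegular_quotSMulTop_pow_and_associatedPrimes_eq {r : R}
    (hr : IsSMulRegular M r) {rs : List R} (hrs : IsWeaklyRegular (QuotSMulTop r M) rs) (n : ℕ) :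
    IsWeaklyRegular (QuotSMulTop (r ^ (n + 1)) M) rs ∧
      associatedPrimes R (QuotSMulTop (r ^ (n + 1)) M ⧸
        (Ideal.ofList rs • ⊤ : Submodule R (QuotSMulTop (r ^ (n + 1)) M))) =
      associatedPrimes R (QuotSMulTop r M ⧸
        (Ideal.ofList rs • ⊤ : Submodule R (QuotSMulTop r M))) := by
  induction n with
  | zero =>
    rw [zero_add, pow_one]
    exact ⟨hrs, rfl⟩
  | succ n ih =>
    obtain ⟨f, g, hf, hfg, hg⟩ := exists_shortExact_quotSMulTop_pow hr (n + 1)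
    obtain ⟨h₁, h₂⟩ := shortExact_mapQ_of_isWeaklyRegular hf hfg hg hrs
    refine ⟨isWeaklyRegular_of_shortExact hf hfg hg ih.1 hrs, Set.Subset.antisymm ?_ ?_⟩
    · have h := associatedPrimes.subset_union_of_exact h₁ h₂
      rwa [ih.2, Set.union_self] at h
    · rw [← ih.2]
      exact associatedPrimes.subset_of_injective h₁

/-- Raising the members of a weakly regular sequence to positive powers does not change the
associated primes of the quotient. -/
theorem associatedPrimes_quotient_ofList_pow_eq {rs ss : List R}
    (h : List.Forall₂ (fun a b => ∃ n : ℕ, b = a ^ (n + 1)) rs ss)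
    (hrs : IsWeaklyRegular M rs) :
    associatedPrimes R (M ⧸ (Ideal.ofList ss • ⊤ : Submodule R M)) =
      associatedPrimes R (M ⧸ (Ideal.ofList rs • ⊤ : Submodule R M)) := by
  induction h generalizing M with
  | nil => rfl
  | @cons a b rs ss hab _ ih =>
    obtain ⟨n, rfl⟩ := hab
    obtain ⟨ha, hrs⟩ := (isWeaklyRegular_cons_iff M a rs).mp hrs
    obtain ⟨h₁, h₂⟩ := isWeaklyRegular_quotSMulTop_pow_and_associatedPrimes_eq ha hrs n
    rw [LinearEquiv.AssociatedPrimes.eq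
        (Submodule.quotOfListConsSMulTopEquivQuotSMulTopInner M a rs),
      LinearEquiv.AssociatedPrimes.eq
        (Submodule.quotOfListConsSMulTopEquivQuotSMulTopInner M _ ss),
      ih h₁, h₂]

end Powers

section Localization

variable {R M L : Type*} [CommRing R] [IsNoetherianRing R] [AddCommGroup M] [AddCommGroup L]
  [Module R M] [Module R L]

theorem mem_associatedPrimes_localizedModule_self (p : Ideal R) [p.IsPrime] (f : M →ₗ[R] L)
    [IsLocalizedModule p.primeCompl f] (hp : p ∈ associatedPrimes R M) :
    p ∈ associatedPrimes R L := by
  rw [AssociatedPrimes.mem_iff, isAssociatedPrime_iff] at hp ⊢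
  obtain ⟨hp', x, hx⟩ := hp
  have hmem : ∀ r, r ∈ p ↔ r • x = 0 := fun r => by
    conv_lhs => rw [hx]
    simp [Submodule.mem_colon_singleton]
  refine ⟨hp', f x, le_antisymm (fun r hr => ?_) (fun r hr => ?_)⟩
  · rw [Submodule.mem_colon_singleton, Submodule.mem_bot, ← map_smul, (hmem r).mp hr, map_zero]
  · rw [Submodule.mem_colon_singleton, Submodule.mem_bot, ← map_smul,
      IsLocalizedModule.eq_zero_iff p.primeCompl] at hr
    obtain ⟨c, hc⟩ := hr
    rw [Submonoid.smul_def, smul_smul, ← hmem] at hc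
    exact (hp'.mem_or_mem hc).resolve_left c.2

theorem exists_smul_eq_zero_of_fg {S : Submonoid R} (f : M →ₗ[R] L) [IsLocalizedModule S f]
    (m : M) (I : Ideal R) (hI : ∀ r ∈ I, r • f m = 0) :
    ∃ c : S, ∀ r ∈ I, r • c • m = 0 := by
  have hfg : I.FG := IsNoetherian.noetherian I
  induction I, hfg using Submodule.fg_induction with
  | singleton a =>
    have ha := hI a (Submodule.mem_span_singleton_self a)
    rw [← map_smul, IsLocalizedModule.eq_zero_iff S] at ha
    obtain ⟨c, hc⟩ := ha
    refine ⟨c, fun r hr => ?_⟩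
    obtain ⟨b, rfl⟩ := Submodule.mem_span_singleton.mp hr
    rw [smul_assoc, smul_comm a c, hc, smul_zero]
  | sup I J _ _ ihI ihJ =>
    obtain ⟨c, hc⟩ := ihI fun r hr => hI r (Submodule.mem_sup_left hr)
    obtain ⟨d, hd⟩ := ihJ fun r hr => hI r (Submodule.mem_sup_right hr)
    refine ⟨c * d, fun r hr => ?_⟩
    obtain ⟨a, ha, b, hb, rfl⟩ := Submodule.mem_sup.mp hr
    rw [add_smul, mul_smul, smul_comm b c, hd b hb, smul_zero, add_zero, smul_comm c d,
      smul_comm a d, hc a ha, smul_zero]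

theorem le_and_mem_associatedPrimes_of_localizedModule (p : Ideal R) [p.IsPrime]
    (f : M →ₗ[R] L) [IsLocalizedModule p.primeCompl f] {q : Ideal R}
    (hq : q ∈ associatedPrimes R L) : q ≤ p ∧ q ∈ associatedPrimes R M := by
  rw [AssociatedPrimes.mem_iff, isAssociatedPrime_iff] at hq ⊢
  obtain ⟨hq', y, hy⟩ := hq
  have hmem : ∀ r, r ∈ q ↔ r • y = 0 := fun r => by
    conv_lhs => rw [hy]
    simp [Submodule.mem_colon_singleton]
  have hle : q ≤ p := by
    intro r hr
    by_contra hrp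
    have h0 := IsLocalizedModule.smul_injective f (⟨r, hrp⟩ : p.primeCompl)
      (a₁ := y) (a₂ := 0) (by simpa [Submonoid.smul_def] using (hmem r).mp hr)
    exact hq'.ne_top ((Ideal.eq_top_iff_one q).mpr ((hmem 1).mpr (by rw [h0, smul_zero])))
  obtain ⟨⟨m, s⟩, hs⟩ := IsLocalizedModule.surj p.primeCompl f y
  obtain ⟨c, hc⟩ := exists_smul_eq_zero_of_fg (S := p.primeCompl) f m q fun r hr => by
    rw [← hs, smul_comm, (hmem r).mp hr, smul_zero]
  refine ⟨hle, hq', c • m, le_antisymm (fun r hr => ?_) (fun r hr => ?_)⟩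
  · rw [Submodule.mem_colon_singleton, Submodule.mem_bot, hc r hr]
  · rw [Submodule.mem_colon_singleton, Submodule.mem_bot] at hr
    have h := congrArg f hr
    rw [Submonoid.smul_def, map_smul, map_smul, map_zero, ← hs, Submonoid.smul_def, smul_smul,
      smul_smul, ← hmem] at h
    exact (hq'.mem_or_mem h).elim
      (fun h => (hq'.mem_or_mem h).resolve_right fun h => c.2 (hle h))
      (fun h => absurd (hle h) s.2)

end Localization

/-- Localization commutes with the formation of `M / I M`. -/
theorem exists_isLocalizedModule_quotient_smul_top {R : Type*} [CommRing R] (p : Ideal R)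
    [p.IsPrime] (M : Type*) [AddCommGroup M] [Module R M] (I : Ideal R) :
    ∃ g : (M ⧸ (I • ⊤ : Submodule R M)) →ₗ[R]
        LocalizedModule p.primeCompl M ⧸ (I • ⊤ : Submodule R (LocalizedModule p.primeCompl M)),
      IsLocalizedModule p.primeCompl g := by
  let P := (I • ⊤ : Submodule R M).localized p.primeCompl
  have hP : P.restrictScalars R = I • ⊤ := by
    change (I • ⊤ : Submodule R M).localized₀ p.primeCompl (LocalizedModule.mkLinearMap _ M) = _
    rw [Submodule.localized₀_smul, Submodule.localized₀_top]
  let e := (Submodule.Quotient.restrictScalarsEquiv R P).symm ≪≫ₗ Submodule.quotEquivOfEq _ _ hP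
  exact ⟨e.toLinearMap ∘ₗ (I • ⊤ : Submodule R M).toLocalizedQuotient p.primeCompl,
    IsLocalizedModule.of_linearEquiv _ _ e⟩

theorem zdim_lt_ringKrullDim_quotient_of_lt {R : Type} [CommRing R] {k : ℤ} {p q : Ideal R}
    [hq : q.IsPrime] (hp : p ≠ ⊤) (hlt : q < p) (hk : p ∈ dimGE R k) :
    zdim k < ringKrullDim (R ⧸ q) := by
  obtain ⟨a, hap, haq⟩ := SetLike.exists_of_lt hlt
  have : Nontrivial (R ⧸ p) := Ideal.Quotient.nontrivial_iff.mpr hp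
  have hle : ringKrullDim (R ⧸ p) + 1 ≤ ringKrullDim (R ⧸ q) :=
    ringKrullDim_succ_le_of_surjective (Ideal.Quotient.factor hlt.le)
      (Ideal.Quotient.factor_surjective hlt.le) (r := Ideal.Quotient.mk q a)
      (mem_nonZeroDivisors_of_ne_zero (by rwa [Ne, Ideal.Quotient.eq_zero_iff_mem]))
      (by rwa [Ideal.Quotient.factor_mk, Ideal.Quotient.eq_zero_iff_mem])
  have hk' : zdim k ≤ ringKrullDim (R ⧸ p) := hk
  have h0 : (0 : WithBot ℕ∞) ≤ ringKrullDim (R ⧸ p) := ringKrullDim_nonneg_of_nontrivial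
  unfold zdim at hk' ⊢
  split_ifs with hneg
  · exact (bot_lt_iff_ne_bot.mpr WithBot.zero_ne_bot).trans_le
      (h0.trans ((le_add_of_nonneg_right zero_le_one).trans hle))
  · rw [if_neg hneg] at hk'
    refine lt_of_lt_of_le ?_ ((add_le_add_left hk' 1).trans hle)
    exact_mod_cast Nat.lt_succ_self k.toNat

theorem prefIdeal_eq_ofList {R : Type} [CommRing R] {r : ℕ} (x : Fin r → R) (j : ℕ) :
    prefIdeal x j = Ideal.ofList ((List.ofFn x).take j) := by
  rw [prefIdeal, Ideal.ofList]
  congr 1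
  ext a
  simp only [Set.mem_image, Set.mem_ofPred_eq, List.mem_take_iff_getElem, List.getElem_ofFn,
    List.length_ofFn, lt_inf_iff]
  constructor
  · rintro ⟨i, hi, rfl⟩
    exact ⟨i, ⟨hi, i.2⟩, rfl⟩
  · rintro ⟨i, hi, rfl⟩
    exact ⟨⟨i, hi.2⟩, hi.1, rfl⟩

/-- If `p` with `dim (R / p) ≥ k` is not associated to any earlier quotient, then localizing at `p`
turns an initial segment of a sequence in dimension `> k` into a weakly regular sequence. -/
theorem IsSeqInDimGT.isWeaklyRegular_localizedModule {R : Type} [CommRing R] [IsNoetherianRing R]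
    {N : Type} [AddCommGroup N] [Module R N] {k : ℤ} {r : ℕ} {x : Fin r → R}
    (hx : IsSeqInDimGT R N k x) {p : Ideal R} [hp : p.IsPrime] (hpk : p ∈ dimGE R k) {j : ℕ}
    (hj : ∀ i < j, p ∉ associatedPrimes R (N ⧸ (prefIdeal x i • ⊤ : Submodule R N))) :
    RingTheory.Sequence.IsWeaklyRegular (LocalizedModule p.primeCompl N)
      ((List.ofFn x).take j) := by
  refine ⟨fun i hi => ?_⟩
  have hij : i < j := by simp at hi; omega
  have hir : i < r := by simp at hi; omega
  rw [List.take_take, min_eq_left hij.le, List.getElem_take, List.getElem_ofFn,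
    ← prefIdeal_eq_ofList]
  by_contra hreg
  have hmem := (Set.ext_iff.mp (biUnion_associatedPrimes_eq_compl_regular R
    (LocalizedModule p.primeCompl N ⧸
      (prefIdeal x i • ⊤ : Submodule R (LocalizedModule p.primeCompl N)))) (x ⟨i, hir⟩)).mpr hreg
  obtain ⟨q, hq, hxq⟩ := Set.mem_iUnion₂.mp hmem
  obtain ⟨g, _⟩ := exists_isLocalizedModule_quotient_smul_top p N (prefIdeal x i)
  obtain ⟨hle, hqN⟩ := le_and_mem_associatedPrimes_of_localizedModule p g hq
  have hlt : q < p := lt_of_le_of_ne hle fun h => hj i hij (h ▸ hqN)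
  have : q.IsPrime := hqN.isPrime
  exact hx ⟨i, hir⟩ q hqN (zdim_lt_ringKrullDim_quotient_of_lt hp.ne_top hlt hpk) hxq

theorem IsSeqInDimGT.mem_associatedPrimes_pow_iff {R : Type} [CommRing R] [IsNoetherianRing R]
    {N : Type} [AddCommGroup N] [Module R N] {k : ℤ} {r : ℕ} {x : Fin r → R}
    (hx : IsSeqInDimGT R N k x) {n : Fin r → ℕ} (hn : ∀ i, 0 < n i) {p : Ideal R}
    (hpk : p ∈ dimGE R k) {j : ℕ}
    (hj : ∀ i < j, p ∉ associatedPrimes R (N ⧸ (prefIdeal x i • ⊤ : Submodule R N))) :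
    p ∈ associatedPrimes R
        (N ⧸ (prefIdeal (fun i => x i ^ n i) j • ⊤ : Submodule R N)) ↔
      p ∈ associatedPrimes R (N ⧸ (prefIdeal x j • ⊤ : Submodule R N)) := by
  by_cases hp : p.IsPrime
  · have hlocal (I : Ideal R) : p ∈ associatedPrimes R (N ⧸ (I • ⊤ : Submodule R N)) ↔
        p ∈ associatedPrimes R (LocalizedModule p.primeCompl N ⧸
          (I • ⊤ : Submodule R (LocalizedModule p.primeCompl N))) := by
      obtain ⟨g, _⟩ := exists_isLocalizedModule_quotient_smul_top p N I
      exact ⟨mem_associatedPrimes_localizedModule_self p g,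
        fun h => (le_and_mem_associatedPrimes_of_localizedModule p g h).2⟩
    have hpow : List.Forall₂ (fun a b => ∃ m : ℕ, b = a ^ (m + 1))
        (List.ofFn x) (List.ofFn fun i => x i ^ n i) := by
      rw [List.forall₂_iff_get]
      refine ⟨by simp, fun i h₁ h₂ => ⟨n ⟨i, by simpa using h₁⟩ - 1, ?_⟩⟩
      rw [Nat.sub_add_cancel (hn _)]
      simp
    rw [hlocal, hlocal, prefIdeal_eq_ofList, prefIdeal_eq_ofList,
      associatedPrimes_quotient_ofList_pow_eq (List.forall₂_take j hpow)
        (hx.isWeaklyRegular_localizedModule hpk hj)]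
  · exact iff_of_false (fun h => hp h.isPrime) (fun h => hp h.isPrime)

theorem IsSeqInDimGT.iUnion_associatedPrimes_pow_eq {R : Type} [CommRing R] [IsNoetherianRing R]
    {N : Type} [AddCommGroup N] [Module R N] {k : ℤ} {r : ℕ} {x : Fin r → R}
    (hx : IsSeqInDimGT R N k x) {n : Fin r → ℕ} (hn : ∀ i, 0 < n i) :
    (⋃ j ≤ r, associatedPrimes R
        (N ⧸ (prefIdeal (fun i => x i ^ n i) j • ⊤ : Submodule R N)) ∩ dimGE R k)
      = ⋃ j ≤ r, associatedPrimes R (N ⧸ (prefIdeal x j • ⊤ : Submodule R N)) ∩ dimGE R k := by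
  classical
  ext p
  simp only [Set.mem_iUnion, Set.mem_inter_iff, exists_prop]
  constructor
  · rintro ⟨j, hjr, hp, hpk⟩
    by_cases h : ∀ i < j, p ∉ associatedPrimes R (N ⧸ (prefIdeal x i • ⊤ : Submodule R N))
    · exact ⟨j, hjr, (hx.mem_associatedPrimes_pow_iff hn hpk h).mp hp, hpk⟩
    · push Not at h
      obtain ⟨i, hij, hi⟩ := h
      exact ⟨i, hij.le.trans hjr, hi, hpk⟩
  · rintro ⟨j, hjr, hp, hpk⟩
    have hex : ∃ i, p ∈ associatedPrimes R (N ⧸ (prefIdeal x i • ⊤ : Submodule R N)) := ⟨j, hp⟩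
    exact ⟨Nat.find hex, (Nat.find_min' hex hp).trans hjr,
      (hx.mem_associatedPrimes_pow_iff hn hpk fun _ => Nat.find_min hex).mpr (Nat.find_spec hex),
      hpk⟩

/-- Corollary: for an `N`-sequence `x₁,…,x_r` in dimension `> k` and positive integers
`n₁,…,n_r`, `⋃_{j≤r} Ass_R(N/(x₁^{n₁},…,x_j^{n_j})N)_{≥k} = ⋃_{j≤r} Ass_R(N/(x₁,…,x_j)N)_{≥k}`;
in particular the union over all `(n₁,…,n_r)` is finite. -/
theorem ass_quotient_powers_eq (R : Type) [CommRing R] [IsNoetherianRing R] [IsLocalRing R]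
    (N : Type) [AddCommGroup N] [Module R N] [Module.Finite R N]
    (k : ℤ) (hk : -1 ≤ k) (r : ℕ) (x : Fin r → R)
    (hxm : ∀ i, x i ∈ maximalIdeal R) (hx : IsSeqInDimGT R N k x) :
    (∀ n : Fin r → ℕ, (∀ i, 0 < n i) →
      (⋃ j ≤ r, associatedPrimes R
          (N ⧸ (prefIdeal (fun i => x i ^ n i) j • ⊤ : Submodule R N)) ∩ dimGE R k)
        = ⋃ j ≤ r, associatedPrimes R (N ⧸ (prefIdeal x j • ⊤ : Submodule R N)) ∩ dimGE R k)
    ∧ (⋃ (n : Fin r → ℕ) (_ : ∀ i, 0 < n i), ⋃ j ≤ r,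
        associatedPrimes R (N ⧸ (prefIdeal (fun i => x i ^ n i) j • ⊤ : Submodule R N))
          ∩ dimGE R k).Finite := by
  refine ⟨fun n hn => hx.iUnion_associatedPrimes_pow_eq hn, ?_⟩
  refine Set.Finite.subset (s := ⋃ j ≤ r,
    associatedPrimes R (N ⧸ (prefIdeal x j • ⊤ : Submodule R N)) ∩ dimGE R k) ?_
    (Set.iUnion₂_subset fun n hn => (hx.iUnion_associatedPrimes_pow_eq hn).subset)
  exact (Set.finite_Iic r).biUnion fun j _ =>
    (associatedPrimes.finite R (N ⧸ (prefIdeal x j • ⊤ : Submodule R N))).inter_of_left _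
end

section
/- Let (R,m) be a Noetherian local ring, N a finitely generated R-module, and x_1,...,x_r a generalized regular sequence of N (i.e., an N-sequence in dimension > 1). Then for all positive integers n_1,...,n_r, ⋃_{j≤r} Ass_R(N/(x_1^{n_1},...,x_j^{n_j})N) ∪ {m} = ⋃_{j≤r} Ass_R(N/(x_1,...,x_j)N) ∪ {m}. In particular, the union over all (n_1,...,n_r) ∈ ℕ^r of ⋃_{j≤r} Ass_R(N/(x_1^{n_1},...,x_j^{n_j})N) is a finite set. -/
open CategoryTheory Opposite IsLocalRing

open scoped Pointwise in
lemma smul_top_le_comap_lsmul_mul_smul_top {R : Type*} (M : Type*) [CommRing R] [AddCommGroup M]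
    [Module R M] (a b : R) : a • (⊤ : Submodule R M) ≤
      ((b * a) • (⊤ : Submodule R M)).comap (LinearMap.lsmul R M b) := by
  rintro _ ⟨m, -, rfl⟩
  exact ⟨m, trivial, by simpa [mul_smul] using smul_comm b a m⟩

open scoped Pointwise in
lemma mapQ_lsmul_injective {R M : Type*} [CommRing R] [AddCommGroup M] [Module R M]
    (a : R) {b : R} (hb : IsSMulRegular M b) : Function.Injective
      (Submodule.mapQ _ _ _ (smul_top_le_comap_lsmul_mul_smul_top M a b)) := by
  rw [injective_iff_map_eq_zero]
  intro z hz
  obtain ⟨m, rfl⟩ := Submodule.Quotient.mk_surjective _ z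
  rw [Submodule.mapQ_apply, Submodule.Quotient.mk_eq_zero] at hz
  rw [Submodule.Quotient.mk_eq_zero]
  obtain ⟨n, -, hn⟩ := hz
  exact ⟨n, trivial, hb (by simpa [mul_smul] using hn)⟩

lemma associatedPrimes_quotSMulTop_subset_mul {R M : Type*} [CommRing R] [AddCommGroup M]
    [Module R M] (a : R) {b : R} (hb : IsSMulRegular M b) :
    associatedPrimes R (QuotSMulTop a M) ⊆ associatedPrimes R (QuotSMulTop (b * a) M) :=
  associatedPrimes.subset_of_injective (mapQ_lsmul_injective a hb)

open scoped Pointwise in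
lemma associatedPrimes_quotSMulTop_mul_subset {R M : Type*} [CommRing R] [AddCommGroup M]
    [Module R M] (a : R) {b : R} (hb : IsSMulRegular M b) :
    associatedPrimes R (QuotSMulTop (b * a) M) ⊆
      associatedPrimes R (QuotSMulTop a M) ∪ associatedPrimes R (QuotSMulTop b M) := by
  have hle : (b * a) • (⊤ : Submodule R M) ≤ b • (⊤ : Submodule R M) := by
    rintro _ ⟨m, -, rfl⟩
    exact ⟨a • m, trivial, by simpa [mul_smul] using (smul_comm b a m).symm⟩
  refine associatedPrimes.subset_union_of_exact (mapQ_lsmul_injective a hb)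
    (g := Submodule.factor hle) fun z => ?_
  obtain ⟨m, rfl⟩ := Submodule.Quotient.mk_surjective _ z
  constructor
  · intro h
    replace h : (Submodule.Quotient.mk m : M ⧸ b • (⊤ : Submodule R M)) = 0 := h
    rw [Submodule.Quotient.mk_eq_zero] at h
    obtain ⟨n, -, rfl⟩ := h
    exact ⟨Submodule.Quotient.mk n, rfl⟩
  · rintro ⟨w, hw⟩
    obtain ⟨n, rfl⟩ := Submodule.Quotient.mk_surjective _ w
    rw [← hw]
    change (Submodule.Quotient.mk (b • n) : M ⧸ b • (⊤ : Submodule R M)) = 0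
    rw [Submodule.Quotient.mk_eq_zero]
    exact ⟨n, trivial, rfl⟩

lemma associatedPrimes_quotSMulTop_pow {R M : Type*} [CommRing R] [AddCommGroup M]
    [Module R M] {a : R} (ha : IsSMulRegular M a) {n : ℕ} (hn : 0 < n) :
    associatedPrimes R (QuotSMulTop (a ^ n) M) = associatedPrimes R (QuotSMulTop a M) := by
  induction n, hn using Nat.le_induction with
  | base => rw [Nat.succ_eq_add_one, zero_add, pow_one]
  | succ n hn ih =>
    apply subset_antisymm
    · rw [pow_succ']
      exact (associatedPrimes_quotSMulTop_mul_subset (a ^ n) ha).trans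
        (Set.union_subset ih.subset subset_rfl)
    · rw [pow_succ]
      exact associatedPrimes_quotSMulTop_subset_mul a (ha.pow n)

open RingTheory.Sequence in
/-- Over a Noetherian local ring, replacing the members of a weakly regular sequence by positive
powers keeps it weakly regular and does not change the associated primes of the quotient. -/
lemma RingTheory.Sequence.IsWeaklyRegular.pow_and_associatedPrimes_eq {R : Type*} [CommRing R]
    [IsNoetherianRing R] [IsLocalRing R] {xs ys : List R}
    (hxy : List.Forall₂ (fun x y => ∃ n, 0 < n ∧ y = x ^ n) xs ys)
    {M : Type*} [AddCommGroup M] [Module R M] [Module.Finite R M]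
    (hxs : ∀ x ∈ xs, x ∈ maximalIdeal R) (hreg : IsWeaklyRegular M xs) :
    IsWeaklyRegular M ys ∧ associatedPrimes R (M ⧸ (Ideal.ofList xs • ⊤ : Submodule R M)) =
      associatedPrimes R (M ⧸ (Ideal.ofList ys • ⊤ : Submodule R M)) := by
  induction hxy generalizing M with
  | nil => exact ⟨hreg, rfl⟩
  | @cons x y xs ys h hxy ih =>
    obtain ⟨n, hn, rfl⟩ := h
    have hxm : x ∈ maximalIdeal R := hxs x (by simp)
    have hxsm : ∀ z ∈ xs, z ∈ maximalIdeal R := fun z hz => hxs z (by simp [hz])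
    have hysm : ∀ z ∈ ys, z ∈ maximalIdeal R := by
      clear ih hreg hxs
      induction hxy with
      | nil => simp
      | cons h _ ih =>
        obtain ⟨k, hk, rfl⟩ := h
        simp only [List.mem_cons, forall_eq_or_imp] at hxsm ⊢
        exact ⟨Ideal.pow_mem_of_mem _ hxsm.1 _ hk, ih hxsm.2⟩
    rw [isWeaklyRegular_cons_iff] at hreg
    obtain ⟨hys, hass⟩ := ih (M := QuotSMulTop x M) hxsm hreg.2
    have hperm : IsWeaklyRegular M (ys ++ [x]) :=
      IsLocalRing.isWeaklyRegular_of_perm_of_subset_maximalIdeal (.cons hreg.1 hys)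
        (List.perm_append_singleton x ys).symm (List.forall_mem_cons.mpr ⟨hxm, hysm⟩)
    rw [isWeaklyRegular_append_iff, isWeaklyRegular_singleton_iff] at hperm
    constructor
    · refine IsLocalRing.isWeaklyRegular_of_perm_of_subset_maximalIdeal (rs := ys ++ [x ^ n])
        ?_ (List.perm_append_singleton _ ys) ?_
      · rw [isWeaklyRegular_append_iff, isWeaklyRegular_singleton_iff]
        exact ⟨hperm.1, hperm.2.pow n⟩
      · exact List.forall_mem_append.mpr
          ⟨hysm, List.forall_mem_singleton.mpr (Ideal.pow_mem_of_mem _ hxm _ hn)⟩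
    · rw [LinearEquiv.AssociatedPrimes.eq
          (Submodule.quotOfListConsSMulTopEquivQuotSMulTopInner M x xs), hass,
        ← LinearEquiv.AssociatedPrimes.eq
          (Submodule.quotOfListConsSMulTopEquivQuotSMulTopInner M x ys),
        LinearEquiv.AssociatedPrimes.eq
          (Submodule.quotOfListConsSMulTopEquivQuotSMulTopOuter M x ys),
        LinearEquiv.AssociatedPrimes.eq
          (Submodule.quotOfListConsSMulTopEquivQuotSMulTopOuter M (x ^ n) ys),
        associatedPrimes_quotSMulTop_pow hperm.2 hn]

lemma comap_mem_associatedPrimes_quotient_smul_top_iff {R N : Type*} [CommRing R]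
    [IsNoetherianRing R] [AddCommGroup N] [Module R N] (p I : Ideal R) [p.IsPrime]
    (q : Ideal (Localization.AtPrime p)) :
    q.comap (algebraMap R (Localization.AtPrime p)) ∈
        associatedPrimes R (N ⧸ (I • ⊤ : Submodule R N)) ↔
      q ∈ associatedPrimes (Localization.AtPrime p) (LocalizedModule p.primeCompl N ⧸
        (I.map (algebraMap R (Localization.AtPrime p)) • ⊤ :
          Submodule (Localization.AtPrime p) (LocalizedModule p.primeCompl N))) := by
  have hloc : (I • ⊤ : Submodule R N).localized' (Localization.AtPrime p) p.primeCompl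
      (LocalizedModule.mkLinearMap p.primeCompl N) =
        I.map (algebraMap R (Localization.AtPrime p)) • ⊤ := by
    rw [Submodule.localized'_smul, Ideal.localized'_eq_map, Submodule.localized'_top]
  open Module.associatedPrimes in
  rw [← hloc,
    ← preimage_comap_associatedPrimes_eq_associatedPrimes_of_isLocalizedModule p.primeCompl
      (Localization.AtPrime p) ((I • ⊤ : Submodule R N).toLocalizedQuotient'
        (Localization.AtPrime p) p.primeCompl (LocalizedModule.mkLinearMap p.primeCompl N))]
  rfl

lemma ofList_take_ofFn {R : Type} [CommRing R] {r : ℕ} (x : Fin r → R) (j : ℕ) :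
    Ideal.ofList ((List.ofFn x).take j) = prefIdeal x j := by
  refine congrArg Ideal.span (Set.ext fun z => ?_)
  simp only [Set.mem_ofPred_eq, List.mem_take_iff_getElem, Set.mem_image]
  constructor
  · rintro ⟨i, hi, rfl⟩
    simp only [List.length_ofFn, lt_inf_iff] at hi
    exact ⟨⟨i, hi.2⟩, hi.1, by simp⟩
  · rintro ⟨i, hi, rfl⟩
    exact ⟨i, by simpa using hi, by simp⟩

lemma isWeaklyRegular_localizedModule_take_ofFn {R N : Type} [CommRing R] [IsNoetherianRing R]
    [AddCommGroup N] [Module R N] (p : Ideal R) [p.IsPrime] {r : ℕ} (x : Fin r → R) (j : ℕ)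
    (h : ∀ i : Fin r, (i : ℕ) < j → ∀ q ∈ associatedPrimes R
      (N ⧸ (prefIdeal x (i : ℕ) • ⊤ : Submodule R N)), q ≤ p → x i ∉ q) :
    RingTheory.Sequence.IsWeaklyRegular (LocalizedModule p.primeCompl N)
      (((List.ofFn x).take j).map (algebraMap R (Localization.AtPrime p))) := by
  constructor
  intro i hi
  simp only [List.length_map, List.length_take, List.length_ofFn, lt_inf_iff] at hi
  rw [← List.map_take, List.take_take, min_eq_left hi.1.le, ← Ideal.map_ofList, ofList_take_ofFn]
  by_contra hreg
  have hmem := (Set.ext_iff.mp (biUnion_associatedPrimes_eq_compl_regular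
    (R := Localization.AtPrime p) (M := LocalizedModule p.primeCompl N ⧸
      ((prefIdeal x i).map (algebraMap R (Localization.AtPrime p)) • ⊤ :
        Submodule (Localization.AtPrime p) (LocalizedModule p.primeCompl N)))) _).mpr hreg
  simp only [Set.mem_iUnion, exists_prop] at hmem
  obtain ⟨q, hq, hxq⟩ := hmem
  refine h ⟨i, hi.2⟩ hi.1 _ ((comap_mem_associatedPrimes_quotient_smul_top_iff p _ q).mpr hq) ?_ ?_
  · have := Ideal.comap_mono (f := algebraMap R (Localization.AtPrime p))
      (IsLocalRing.le_maximalIdeal hq.isPrime.ne_top)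
    rwa [← Ideal.under, ← Ideal.under, Localization.AtPrime.under_maximalIdeal] at this
  · simpa using hxq

/-- If, up to `j`, the entries of `x` lie in `p` and form a weakly regular sequence locally at `p`,
then `p` is associated to `N/(x₀,…,x_{j-1})N` iff it is for positive powers of the entries. -/
lemma mem_associatedPrimes_prefIdeal_pow_iff {R N : Type} [CommRing R] [IsNoetherianRing R]
    [AddCommGroup N] [Module R N] [Module.Finite R N] (p : Ideal R) [p.IsPrime] {r : ℕ}
    (x : Fin r → R) (n : Fin r → ℕ) (hn : ∀ i, 0 < n i) (j : ℕ)
    (hp : ∀ i : Fin r, (i : ℕ) < j → x i ∈ p)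
    (h : ∀ i : Fin r, (i : ℕ) < j → ∀ q ∈ associatedPrimes R
      (N ⧸ (prefIdeal x (i : ℕ) • ⊤ : Submodule R N)), q ≤ p → x i ∉ q) :
    p ∈ associatedPrimes R (N ⧸ (prefIdeal (fun i => x i ^ n i) j • ⊤ : Submodule R N)) ↔
      p ∈ associatedPrimes R (N ⧸ (prefIdeal x j • ⊤ : Submodule R N)) := by
  have key (I : Ideal R) := comap_mem_associatedPrimes_quotient_smul_top_iff (N := N) p I
    (maximalIdeal (Localization.AtPrime p))
  simp only [← Ideal.under_def, Localization.AtPrime.under_maximalIdeal] at key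
  rw [key, key, ← ofList_take_ofFn, ← ofList_take_ofFn, Ideal.map_ofList, Ideal.map_ofList]
  rw [((isWeaklyRegular_localizedModule_take_ofFn p x j h).pow_and_associatedPrimes_eq ?_ ?_).2]
  · rw [List.forall₂_iff_get]
    refine ⟨by simp, fun i h₁ h₂ => ⟨n ⟨i, ?_⟩, hn _, ?_⟩⟩
    · rw [List.length_map, List.length_take, List.length_ofFn] at h₁
      exact h₁.trans_le (min_le_right _ _)
    · simp
  · intro z hz
    simp only [List.mem_map, List.mem_take_iff_getElem] at hz
    obtain ⟨_, ⟨i, hi, rfl⟩, rfl⟩ := hz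
    simp only [List.length_ofFn, lt_inf_iff] at hi
    rw [IsLocalization.AtPrime.to_map_mem_maximal_iff (Localization.AtPrime p) p]
    simpa using hp ⟨i, hi.2⟩ hi.1

lemma zdim_one_lt_ringKrullDim_quotient {R : Type} [CommRing R] [IsLocalRing R] {q p : Ideal R}
    [hq : q.IsPrime] [hp : p.IsPrime] (hqp : q < p) (hpm : p ≠ maximalIdeal R) :
    zdim 1 < ringKrullDim (R ⧸ q) := by
  have hpm' : p < maximalIdeal R := lt_of_le_of_ne (IsLocalRing.le_maximalIdeal hp.ne_top) hpm
  rw [ringKrullDim_quotient]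
  let a : PrimeSpectrum.zeroLocus (q : Set R) := ⟨⟨q, hq⟩, le_refl q⟩
  let b : PrimeSpectrum.zeroLocus (q : Set R) := ⟨⟨p, hp⟩, hqp.le⟩
  let c : PrimeSpectrum.zeroLocus (q : Set R) :=
    ⟨⟨maximalIdeal R, inferInstance⟩, (hqp.trans hpm').le⟩
  have hbc : b < c := hpm'
  have hab : a < b := hqp
  let s : LTSeries (PrimeSpectrum.zeroLocus (q : Set R)) :=
    { length := 2
      toFun := ![a, b, c]
      step := fun i => by
        fin_cases i
        · exact hab
        · exact hbc }
  refine lt_of_lt_of_le ?_ (Order.LTSeries.length_le_krullDim s)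
  exact WithBot.coe_lt_coe.mpr (WithTop.coe_lt_coe.mpr one_lt_two)

lemma le_of_mem_associatedPrimes_quotient_smul_top {R N : Type*} [CommRing R] [AddCommGroup N]
    [Module R N] {I p : Ideal R} (hp : p ∈ associatedPrimes R (N ⧸ (I • ⊤ : Submodule R N))) :
    I ≤ p := by
  refine le_trans (fun a ha => ?_) (IsAssociatedPrime.annihilator_le hp)
  rw [Submodule.mem_annihilator]
  intro z _
  obtain ⟨m, rfl⟩ := Submodule.Quotient.mk_surjective _ z
  rw [← Submodule.Quotient.mk_smul, Submodule.Quotient.mk_eq_zero]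
  exact Submodule.smul_mem_smul ha trivial

lemma mem_prefIdeal {R : Type} [CommRing R] {r : ℕ} (x : Fin r → R) {j : ℕ} {i : Fin r}
    (hi : (i : ℕ) < j) : x i ∈ prefIdeal x j :=
  Ideal.subset_span ⟨i, hi, rfl⟩

/-- Corollary: for a generalized regular sequence (an `N`-sequence in dimension `> 1`)
`x₁,…,x_r` and positive integers `n₁,…,n_r`,
`⋃_{j≤r} Ass_R(N/(x₁^{n₁},…,x_j^{n_j})N) ∪ {m} = ⋃_{j≤r} Ass_R(N/(x₁,…,x_j)N) ∪ {m}`;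
in particular the union over all `(n₁,…,n_r)` is finite. -/
theorem ass_quotient_powers_gen_reg (R : Type) [CommRing R] [IsNoetherianRing R] [IsLocalRing R]
    (N : Type) [AddCommGroup N] [Module R N] [Module.Finite R N]
    (r : ℕ) (x : Fin r → R)
    (hxm : ∀ i, x i ∈ maximalIdeal R) (hx : IsSeqInDimGT R N 1 x) :
    (∀ n : Fin r → ℕ, (∀ i, 0 < n i) →
      ((⋃ j ≤ r, associatedPrimes R
          (N ⧸ (prefIdeal (fun i => x i ^ n i) j • ⊤ : Submodule R N))) ∪ {maximalIdeal R}
        = (⋃ j ≤ r, associatedPrimes R (N ⧸ (prefIdeal x j • ⊤ : Submodule R N)))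
            ∪ {maximalIdeal R}))
    ∧ (⋃ (n : Fin r → ℕ) (_ : ∀ i, 0 < n i), ⋃ j ≤ r,
        associatedPrimes R
          (N ⧸ (prefIdeal (fun i => x i ^ n i) j • ⊤ : Submodule R N))).Finite := by
  have main : ∀ n : Fin r → ℕ, (∀ i, 0 < n i) → ∀ p : Ideal R, p ≠ maximalIdeal R →
      ((∃ j ≤ r, p ∈ associatedPrimes R
          (N ⧸ (prefIdeal (fun i => x i ^ n i) j • ⊤ : Submodule R N))) ↔
        ∃ j ≤ r, p ∈ associatedPrimes R (N ⧸ (prefIdeal x j • ⊤ : Submodule R N))) := by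
    intro n hn p hpm
    have avoid : ∀ j, p.IsPrime → (∀ k < j, k ≤ r →
        p ∉ associatedPrimes R (N ⧸ (prefIdeal x k • ⊤ : Submodule R N))) →
        ∀ i : Fin r, (i : ℕ) < j → ∀ q ∈ associatedPrimes R
          (N ⧸ (prefIdeal x (i : ℕ) • ⊤ : Submodule R N)), q ≤ p → x i ∉ q := by
      intro j hp hj i hi q hq hqp
      have hqp' : q < p := lt_of_le_of_ne hqp fun h => hj i hi i.2.le (h ▸ hq)
      have := IsAssociatedPrime.isPrime hq
      exact hx i q hq (zdim_one_lt_ringKrullDim_quotient hqp' hpm)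
    constructor
    · rintro ⟨j, hj, hpj⟩
      by_contra! hnot
      have hp := IsAssociatedPrime.isPrime hpj
      refine hnot j hj ((mem_associatedPrimes_prefIdeal_pow_iff p x n hn j (fun i hi => ?_)
        (avoid j hp fun k _ hk => hnot k hk)).mp hpj)
      exact hp.mem_of_pow_mem _ (le_of_mem_associatedPrimes_quotient_smul_top hpj
        (mem_prefIdeal (fun i => x i ^ n i) hi))
    · intro hex
      classical
      obtain ⟨hj, hpj⟩ := Nat.find_spec hex
      have hp := IsAssociatedPrime.isPrime hpj
      refine ⟨Nat.find hex, hj, (mem_associatedPrimes_prefIdeal_pow_iff p x n hn _ (fun i hi =>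
        le_of_mem_associatedPrimes_quotient_smul_top hpj (mem_prefIdeal x hi))
        (avoid _ hp fun k hk hkr hpk => Nat.find_min hex hk ⟨hkr, hpk⟩)).mpr hpj⟩
  refine ⟨fun n hn => Set.ext fun p => ?_, Set.Finite.subset
    (s := (⋃ j ≤ r, associatedPrimes R (N ⧸ (prefIdeal x j • ⊤ : Submodule R N)))
      ∪ {maximalIdeal R}) ?_ fun p hp => ?_⟩
  · by_cases hpm : p = maximalIdeal R
    · simp [hpm]
    · simpa [hpm] using main n hn p hpm
  · exact ((Set.finite_Iic r).biUnion fun j _ => associatedPrimes.finite R _).union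
      (Set.finite_singleton _)
  · by_cases hpm : p = maximalIdeal R
    · simp [hpm]
    · simp only [Set.mem_iUnion, exists_prop] at hp
      obtain ⟨n, hn, hp⟩ := hp
      simpa [hpm] using (main n hn p hpm).mp hp
end
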